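/- arXiv:2509.13463 — 2 statements merged into one kernel-verified Lean document; each statement's English description precedes it below -/
import Mathlib

section
/- Let Δ ≥ 2 and r ≥ Δ+1 be integers, and let λ and λ′ be distinct partitions of Δ−1 (note every partition of Δ−1 has at most Δ−1 ≤ r−2 parts, so A(Δ,λ,r) and A(Δ,λ′,r) are defined). Then the column vector matroids of A(Δ,λ,r) and A(Δ,λ′,r) are not isomorphic: there is no bijection σ from the column index set of A(Δ,λ,r) to that of A(Δ,λ′,r) such that, for every set S of column indices, the columns of A(Δ,λ,r) indexed by S are linearly independent over ℝ if and only if the columns of A(Δ,λ′,r) indexed by σ(S) are linearly independent. -/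
/-- The index set for the columns of `D_r`: pairs `(i, j)` with `i < j`. -/
abbrev PairIdx (r : ℕ) := {p : Fin r × Fin r // p.1 < p.2}

/-- Column index type for the matrix `A(Δ, λ, r)`. -/
abbrev ColIdxLam (m r : ℕ) (lam : Fin m → ℕ) :=
  Fin r ⊕ PairIdx r ⊕ (Σ i : Fin m, Fin (lam i)) ⊕
    (Σ i : Fin m, Fin (lam i) × {j : Fin r // j.val ≠ 0 ∧ j.val ≠ i.val + 1})

/-- The matrix `A(Δ, λ, r)` (with `λ` given as `lam : Fin m → ℕ`, the value `k ∈ [λ_i]`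
represented by `k : Fin (lam i)` standing for `k+1`). -/
def ALam (m r : ℕ) (lam : Fin m → ℕ) : Matrix (Fin r) (ColIdxLam m r lam) ℤ :=
  Matrix.of fun t j =>
    match j with
    | Sum.inl i => if t = i then 1 else 0
    | Sum.inr (Sum.inl p) => if t = p.val.1 then 1 else if t = p.val.2 then -1 else 0
    | Sum.inr (Sum.inr (Sum.inl ⟨i, k⟩)) =>
        if t.val = 0 then (k.val + 1 : ℤ) else if t.val = i.val + 1 then 1 else 0
    | Sum.inr (Sum.inr (Sum.inr ⟨i, k, j⟩)) =>
        if t.val = 0 then (k.val + 1 : ℤ) else if t.val = i.val + 1 then 1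
        else if t.val = j.val.val then -1 else 0

/-- The columns of `A` indexed by `S` are linearly independent over `ℝ`. -/
def ColsIndepR {r : ℕ} {ι : Type} (A : Matrix (Fin r) ι ℤ) (S : Set ι) : Prop :=
  LinearIndependent ℝ (fun j : S => fun i => ((A i j.val : ℤ) : ℝ))

/-- The column vector matroids (over `ℝ`) of two integer matrices are isomorphic. -/
def MatroidIso {r r' : ℕ} {ι ι' : Type} (A : Matrix (Fin r) ι ℤ)
    (B : Matrix (Fin r') ι' ℤ) : Prop :=
  ∃ σ : ι ≃ ι', ∀ S : Set ι, ColsIndepR A S ↔ ColsIndepR B (σ '' S)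

theorem MatroidIso.symm {r r' : ℕ} {ι ι' : Type} {A : Matrix (Fin r) ι ℤ}
    {B : Matrix (Fin r') ι' ℤ} (h : MatroidIso A B) : MatroidIso B A := by
  obtain ⟨σ, hσ⟩ := h
  refine ⟨σ.symm, fun S => ?_⟩
  rw [hσ, σ.image_symm_image]

theorem MatroidIso.trans {r r' r'' : ℕ} {ι ι' ι'' : Type} {A : Matrix (Fin r) ι ℤ}
    {B : Matrix (Fin r') ι' ℤ} {C : Matrix (Fin r'') ι'' ℤ}
    (h : MatroidIso A B) (h' : MatroidIso B C) : MatroidIso A C := by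
  obtain ⟨σ, hσ⟩ := h
  obtain ⟨τ, hτ⟩ := h'
  refine ⟨σ.trans τ, fun S => ?_⟩
  rw [hσ, hτ, Set.image_image]
  rfl

/-- Relabelling columns and changing signs does not change the column matroid. -/
theorem MatroidIso.of_sign {r : ℕ} {ι ι' : Type} {A : Matrix (Fin r) ι ℤ}
    {B : Matrix (Fin r) ι' ℤ} (φ : ι ≃ ι')
    (h : ∀ e, (∀ t, A t e = B t (φ e)) ∨ (∀ t, A t e = -B t (φ e))) : MatroidIso A B := by
  have h' : ∀ e, ∃ u : ℝˣ, ∀ t, ((A t e : ℤ) : ℝ) = u • ((B t (φ e) : ℤ) : ℝ) := by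
    intro e
    rcases h e with h | h
    · exact ⟨1, fun t => by simp [h]⟩
    · exact ⟨-1, fun t => by simp [h]⟩
  choose u hu using h'
  refine ⟨φ, fun S => ?_⟩
  unfold ColsIndepR
  rw [← linearIndependent_equiv (φ.image S)]
  have : (fun (j : S) i => ((A i j : ℤ) : ℝ)) =
      (fun j : S => u j) •
        ((fun (j : φ '' S) i => ((B i j : ℤ) : ℝ)) ∘ (φ.image S)) := by
    funext j t
    exact hu j t
  rw [this]
  exact LinearIndependent.units_smul_iff _ _

theorem not_colsIndepR_triple {r : ℕ} {ι : Type} {A : Matrix (Fin r) ι ℤ} {a b c : ι}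
    (hab : a ≠ b) (hac : a ≠ c) (hbc : b ≠ c) :
    ¬ ColsIndepR A {a, b, c} ↔ ∃ α β γ : ℝ, (α ≠ 0 ∨ β ≠ 0 ∨ γ ≠ 0) ∧
      ∀ t, α * A t a + β * A t b + γ * A t c = 0 := by
  classical
  have key : ColsIndepR A {a, b, c} ↔
      LinearIndepOn ℝ (fun e t => ((A t e : ℤ) : ℝ)) (({a, b, c} : Finset ι) : Set ι) := by
    simp only [Finset.coe_insert, Finset.coe_singleton]
    rfl
  rw [key, linearIndepOn_finset_iff]
  push Not
  constructor
  · rintro ⟨g, hg, hne⟩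
    refine ⟨g a, g b, g c, by simpa using hne, fun t => ?_⟩
    rw [Finset.sum_insert (by simp [hab, hac]), Finset.sum_pair hbc] at hg
    have := congrFun hg t
    simp at this
    linarith
  · rintro ⟨α, β, γ, hne, hs⟩
    refine ⟨fun e => if e = a then α else if e = b then β else γ, ?_, ?_⟩
    · rw [Finset.sum_insert (by simp [hab, hac]), Finset.sum_pair hbc]
      funext t
      have := hs t
      simp [hab.symm, hac.symm, hbc.symm]
      linarith
    · simpa [hab.symm, hac.symm, hbc.symm] using hne

open Polynomial in
/-- A finite family of natural numbers with a zero entry is determined, up to order, by its sums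
over pairs. -/
theorem sum_X_pow_eq_of_pairs {n : ℕ} {w w' : Fin n → ℕ} (h0 : ∃ i, w i = 0)
    (h0' : ∃ i, w' i = 0)
    (h : ∑ p : PairIdx n, (X : ℚ[X]) ^ (w p.1.1 + w p.1.2) =
      ∑ p : PairIdx n, (X : ℚ[X]) ^ (w' p.1.1 + w' p.1.2)) :
    ∑ i, (X : ℚ[X]) ^ w i = ∑ i, (X : ℚ[X]) ^ w' i := by
  have sq : ∀ v : Fin n → ℕ, (∑ i, (X : ℚ[X]) ^ v i) * (∑ i, (X : ℚ[X]) ^ v i) =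
      expand ℚ 2 (∑ i, (X : ℚ[X]) ^ v i) +
        2 * ∑ p : PairIdx n, (X : ℚ[X]) ^ (v p.1.1 + v p.1.2) := by
    intro v
    have hp : ∑ p : PairIdx n, (X : ℚ[X]) ^ (v p.1.1 + v p.1.2) =
        ∑ i, ∑ j, if i < j then (X : ℚ[X]) ^ (v i + v j) else 0 := by
      rw [← Fintype.sum_prod_type' (f := fun i j => if i < j then (X : ℚ[X]) ^ (v i + v j) else 0),
        ← Finset.sum_filter]
      exact (Finset.sum_subtype _ (by simp) (fun p : Fin n × Fin n => X ^ (v p.1 + v p.2))).symm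
    have hp' : ∑ p : PairIdx n, (X : ℚ[X]) ^ (v p.1.1 + v p.1.2) =
        ∑ i, ∑ j, if j < i then (X : ℚ[X]) ^ (v i + v j) else 0 := by
      rw [hp, Finset.sum_comm]
      simp only [add_comm]
    have hd : expand ℚ 2 (∑ i, (X : ℚ[X]) ^ v i) =
        ∑ i, ∑ j, if i = j then (X : ℚ[X]) ^ (v i + v j) else 0 := by
      simp [map_sum, ← pow_mul, two_mul]
    rw [two_mul]
    nth_rewrite 1 [hp]
    rw [hp', hd, Finset.sum_mul_sum, ← Finset.sum_add_distrib, ← Finset.sum_add_distrib]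
    refine Finset.sum_congr rfl fun i _ => ?_
    rw [← Finset.sum_add_distrib, ← Finset.sum_add_distrib]
    refine Finset.sum_congr rfl fun j _ => ?_
    rw [pow_add]
    rcases lt_trichotomy i j with hij | hij | hij
    · simp [hij, hij.ne, hij.not_gt]
    · simp [hij]
    · simp [hij, hij.ne', hij.not_gt]
  have pos : ∀ v : Fin n → ℕ, (∃ i, v i = 0) → 1 ≤ (∑ i, (X : ℚ[X]) ^ v i).coeff 0 := by
    rintro v ⟨i, hi⟩
    rw [finsetSum_coeff]
    calc (1 : ℚ) = ((X : ℚ[X]) ^ v i).coeff 0 := by simp [hi]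
      _ ≤ _ := Finset.single_le_sum (f := fun i => ((X : ℚ[X]) ^ v i).coeff 0)
          (fun j _ => by rw [coeff_X_pow]; split_ifs <;> norm_num) (Finset.mem_univ i)
  have e1 := sq w
  have e2 := sq w'
  have p1 := pos w h0
  have p2 := pos w' h0'
  rw [h] at e1
  generalize ∑ i, (X : ℚ[X]) ^ w i = f at *
  generalize ∑ i, (X : ℚ[X]) ^ w' i = g at *
  have e : (f - g) * (f + g) = expand ℚ 2 (f - g) := by
    rw [map_sub]
    linear_combination e1 - e2
  by_contra hfg
  have hne : f - g ≠ 0 := sub_ne_zero.mpr hfg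
  have hq : (f + g).coeff 0 ≠ 0 := by rw [coeff_add]; linarith
  have c0 : (f - g).coeff 0 = 0 := by
    have := congrArg (fun P => P.coeff 0) e
    simp only [mul_coeff_zero, coeff_add, coeff_expand two_pos, dvd_zero, if_true, Nat.zero_div] at this
    have h2 : (f - g).coeff 0 * (f.coeff 0 + g.coeff 0 - 1) = 0 := by linarith
    rcases mul_eq_zero.mp h2 with h2 | h2
    · exact h2
    · linarith
  set d := (f - g).natTrailingDegree with hd
  have hd0 : d ≠ 0 := by
    intro h
    have := (trailingCoeff_nonzero_iff_nonzero (p := f - g)).mpr hne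
    rw [trailingCoeff, ← hd, h] at this
    exact this c0
  have hc := congrArg (fun P => P.coeff d) e
  have hl : ((f - g) * (f + g)).coeff d = (f - g).coeff d * (f + g).coeff 0 := by
    have := coeff_mul_natTrailingDegree_add_natTrailingDegree (p := f - g) (q := f + g)
    rw [natTrailingDegree_eq_zero.mpr (Or.inr hq), add_zero, ← hd] at this
    rw [this, trailingCoeff, trailingCoeff, natTrailingDegree_eq_zero.mpr (Or.inr hq)]
  have hr : (expand ℚ 2 (f - g)).coeff d = 0 := by
    rw [coeff_expand (by norm_num)]
    split_ifs with hdvd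
    · exact coeff_eq_zero_of_lt_natTrailingDegree (by omega)
    · rfl
  simp only [hl, hr] at hc
  rcases mul_eq_zero.mp hc with h2 | h2
  · exact (trailingCoeff_nonzero_iff_nonzero (p := f - g)).mpr hne h2
  · exact hq h2

section GainMatrix

variable {n : ℕ} {w w' : Fin (n + 1) → ℕ}

/-- Elements of the gain matroid with vertex weights `w`: a tip, and for each pair `i < j` the
edges from `i` to `j` with gain in `[-w j, w i]`. -/
abbrev GainIdx (w : Fin (n + 1) → ℕ) :=
  Option (Σ p : PairIdx (n + 1), Finset.Icc (-(w p.1.2 : ℤ)) (w p.1.1))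

/-- The endpoints and the gain of an element; the tip is a loop at `0` with gain `1`. -/
def GainIdx.label : GainIdx w → Fin (n + 1) × Fin (n + 1) × ℤ
  | none => (0, 0, 1)
  | some ⟨p, k⟩ => (p.1.1, p.1.2, k)

/-- The gain of an element. -/
def GainIdx.gain (x : GainIdx w) : ℤ := x.label.2.2

/-- The signed incidence vector of an element. -/
def GainIdx.inc (x : GainIdx w) (s : Fin (n + 1)) : ℤ :=
  (if s = x.label.1 then 1 else 0) - (if s = x.label.2.1 then 1 else 0)

/-- The vector attached to a labelled edge: the gain replaces the coordinate at the vertex `0`. -/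
def labelVec (l : Fin (n + 1) × Fin (n + 1) × ℤ) (t : Fin (n + 1)) : ℤ :=
  if t = 0 then l.2.2 else (if t = l.1 then 1 else 0) - (if t = l.2.1 then 1 else 0)

/-- The matrix representing the gain matroid with vertex weights `w`. -/
def gainMatrix (w : Fin (n + 1) → ℕ) : Matrix (Fin (n + 1)) (GainIdx w) ℤ :=
  Matrix.of fun t x => labelVec x.label t

theorem gainMatrix_relation (x y z : GainIdx w) (α β γ : ℝ) :
    (∀ t, α * gainMatrix w t x + β * gainMatrix w t y + γ * gainMatrix w t z = 0) ↔
      α * x.gain + β * y.gain + γ * z.gain = 0 ∧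
        ∀ s, α * x.inc s + β * y.inc s + γ * z.inc s = 0 := by
  have h0 : ∀ e : GainIdx w, gainMatrix w 0 e = e.gain := fun e => by
    simp [gainMatrix, labelVec, GainIdx.gain]
  have h1 : ∀ (e : GainIdx w) (t : Fin n), gainMatrix w t.succ e = e.inc t.succ := fun e t => by
    simp [gainMatrix, labelVec, GainIdx.inc]
  have h2 : ∀ e : GainIdx w, (e.inc 0 : ℝ) + ∑ t : Fin n, (e.inc t.succ : ℝ) = 0 := fun e => by
    rw [← Fin.sum_univ_succ (fun t => (e.inc t : ℝ))]
    simp [GainIdx.inc]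
  rw [Fin.forall_fin_succ]
  simp only [h0, h1]
  refine and_congr_right fun _ => ⟨fun h => Fin.forall_fin_succ.mpr ⟨?_, h⟩,
    fun h t => h t.succ⟩
  have hs := Finset.sum_eq_zero (s := Finset.univ) fun t _ => h t
  rw [Finset.sum_add_distrib, Finset.sum_add_distrib, ← Finset.mul_sum, ← Finset.mul_sum,
    ← Finset.mul_sum] at hs
  linear_combination α * h2 x + β * h2 y + γ * h2 z - hs

@[simp] theorem inc_none (s : Fin (n + 1)) : GainIdx.inc (none : GainIdx w) s = 0 :=
  sub_self _

@[simp] theorem gain_none : GainIdx.gain (none : GainIdx w) = 1 := rfl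

theorem inc_some_ne_zero_iff (x : Σ p : PairIdx (n + 1), Finset.Icc (-(w p.1.2 : ℤ)) (w p.1.1))
    (s : Fin (n + 1)) : GainIdx.inc (some x) s ≠ 0 ↔ s = x.1.1.1 ∨ s = x.1.1.2 := by
  obtain ⟨⟨⟨i, j⟩, hij⟩, k⟩ := x
  simp only [GainIdx.inc, GainIdx.label]
  have : i ≠ j := hij.ne
  split_ifs <;> grind

theorem inc_some_congr {x y : Σ p : PairIdx (n + 1), Finset.Icc (-(w p.1.2 : ℤ)) (w p.1.1)}
    (h : x.1 = y.1) (s : Fin (n + 1)) :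
    GainIdx.inc (some x) s = GainIdx.inc (some y) s := by
  obtain ⟨p, k⟩ := x
  obtain ⟨q, l⟩ := y
  obtain rfl : p = q := h
  rfl

theorem exists_inc_ne_zero
    {x y : Σ p : PairIdx (n + 1), Finset.Icc (-(w p.1.2 : ℤ)) (w p.1.1)} (h : x.1 ≠ y.1) :
    ∃ s, GainIdx.inc (some x) s ≠ 0 ∧ GainIdx.inc (some y) s = 0 := by
  by_contra! hc
  have h1 := hc x.1.1.1 ((inc_some_ne_zero_iff _ _).mpr (Or.inl rfl))
  have h2 := hc x.1.1.2 ((inc_some_ne_zero_iff _ _).mpr (Or.inr rfl))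
  rw [inc_some_ne_zero_iff] at h1 h2
  have hx := x.1.2
  have hy := y.1.2
  apply h
  ext <;> omega

theorem pair_eq_of_inc
    {x y : Σ p : PairIdx (n + 1), Finset.Icc (-(w p.1.2 : ℤ)) (w p.1.1)} {s t : Fin (n + 1)}
    (hst : s ≠ t) (hxs : GainIdx.inc (some x) s ≠ 0) (hxt : GainIdx.inc (some x) t ≠ 0)
    (hys : GainIdx.inc (some y) s ≠ 0) (hyt : GainIdx.inc (some y) t ≠ 0) : x.1 = y.1 := by
  rw [inc_some_ne_zero_iff] at *
  have hx := x.1.2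
  have hy := y.1.2
  ext <;> omega

theorem eq_of_pair_eq {x y : Σ p : PairIdx (n + 1), Finset.Icc (-(w p.1.2 : ℤ)) (w p.1.1)}
    (h : x.1 = y.1) (hg : GainIdx.gain (some x) = GainIdx.gain (some y)) : x = y := by
  obtain ⟨p, k⟩ := x
  obtain ⟨q, l⟩ := y
  obtain rfl : p = q := h
  obtain rfl : k = l := Subtype.ext hg
  rfl

/-- Distinct elements are not parallel. -/
theorem pair_relation {x y : GainIdx w} (hxy : x ≠ y) {α β : ℝ}
    (hg : α * x.gain + β * y.gain = 0) (hi : ∀ s, α * x.inc s + β * y.inc s = 0) :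
    α = 0 ∧ β = 0 := by
  have single : ∀ (z : GainIdx w) (γ : ℝ), γ * z.gain = 0 → (∀ s, γ * z.inc s = 0) → γ = 0 := by
    rintro (_ | z) γ h1 h2
    · simpa using h1
    · have := h2 z.1.1.1
      have h3 := (inc_some_ne_zero_iff z z.1.1.1).mpr (Or.inl rfl)
      simpa [h3] using this
  have hα : α = 0 → α = 0 ∧ β = 0 := by
    rintro rfl
    exact ⟨rfl, single y β (by simpa using hg) (by simpa using hi)⟩
  have hβ : β = 0 → α = 0 ∧ β = 0 := by
    rintro rfl
    exact ⟨single x α (by simpa using hg) (by simpa using hi), rfl⟩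
  rcases x with _ | x <;> rcases y with _ | y
  · exact absurd rfl hxy
  · exact hβ (single (some y) β (by
      have h3 := (inc_some_ne_zero_iff y y.1.1.1).mpr (Or.inl rfl)
      have := hi y.1.1.1
      simp [h3] at this
      simp [this]) (by simpa using hi))
  · exact hα (single (some x) α (by
      have h3 := (inc_some_ne_zero_iff x x.1.1.1).mpr (Or.inl rfl)
      have := hi x.1.1.1
      simp [h3] at this
      simp [this]) (by simpa using hi))
  · by_cases hp : x.1 = y.1
    · have h3 := (inc_some_ne_zero_iff x x.1.1.1).mpr (Or.inl rfl)
      have h4 := hi x.1.1.1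
      rw [← inc_some_congr hp, ← add_mul] at h4
      have h5 : α + β = 0 := by simpa [h3] using h4
      refine hα ?_
      by_contra hne
      apply hxy
      rw [eq_of_pair_eq hp]
      have : α * ((GainIdx.gain (some x) : ℝ) - GainIdx.gain (some y)) = 0 := by
        linear_combination hg - (GainIdx.gain (some y) : ℝ) * h5
      have h6 := (mul_eq_zero.mp this).resolve_left hne
      exact_mod_cast sub_eq_zero.mp h6
    · obtain ⟨s, h1, h2⟩ := exists_inc_ne_zero hp
      have := hi s
      exact hα (by simpa [h1, h2] using this)

/-- Three collinear elements are related with nonzero coefficients. -/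
theorem exists_relation {x y z : GainIdx w} (hxy : x ≠ y) (hxz : x ≠ z) (hyz : y ≠ z)
    (h : ¬ ColsIndepR (gainMatrix w) {x, y, z}) :
    ∃ α β γ : ℝ, α ≠ 0 ∧ β ≠ 0 ∧ γ ≠ 0 ∧ α * x.gain + β * y.gain + γ * z.gain = 0 ∧
      ∀ s, α * x.inc s + β * y.inc s + γ * z.inc s = 0 := by
  obtain ⟨α, β, γ, hne, hrel⟩ := (not_colsIndepR_triple hxy hxz hyz).mp h
  obtain ⟨hg, hi⟩ := (gainMatrix_relation _ _ _ _ _ _).mp hrel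
  refine ⟨α, β, γ, ?_, ?_, ?_, hg, hi⟩ <;> rintro rfl
  · have := pair_relation hyz (α := β) (β := γ) (by simpa using hg) (by simpa using hi)
    simp_all
  · have := pair_relation hxz (α := α) (β := γ) (by simpa using hg) (by simpa using hi)
    simp_all
  · have := pair_relation hxy (α := α) (β := β) (by simpa using hg) (by simpa using hi)
    simp_all

/-- Two edges are collinear with the tip exactly when they have the same endpoints. -/
theorem collinear_tip_iff
    {x y : Σ p : PairIdx (n + 1), Finset.Icc (-(w p.1.2 : ℤ)) (w p.1.1)} (hxy : x ≠ y) :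
    ¬ ColsIndepR (gainMatrix w) {none, some x, some y} ↔ x.1 = y.1 := by
  have hs : (some x : GainIdx w) ≠ some y := fun h => hxy (Option.some.inj h)
  constructor
  · intro h
    by_contra hp
    obtain ⟨α, β, γ, -, hβ, -, -, hi⟩ :=
      exists_relation (Option.some_ne_none x).symm (Option.some_ne_none y).symm hs h
    obtain ⟨s, h1, h2⟩ := exists_inc_ne_zero hp
    have := hi s
    simp [h1, h2, hβ] at this
  · intro hp
    rw [not_colsIndepR_triple (Option.some_ne_none x).symm (Option.some_ne_none y).symm hs]
    refine ⟨GainIdx.gain (some y) - GainIdx.gain (some x), 1, -1, by simp, ?_⟩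
    rw [gainMatrix_relation]
    refine ⟨by simp, fun s => ?_⟩
    rw [inc_some_congr hp]
    simp

theorem collinear_of_pair_eq
    {x y z : Σ p : PairIdx (n + 1), Finset.Icc (-(w p.1.2 : ℤ)) (w p.1.1)} (hxy : x ≠ y)
    (hxz : x ≠ z) (hyz : y ≠ z) (h1 : x.1 = y.1) (h2 : x.1 = z.1) :
    ¬ ColsIndepR (gainMatrix w) {some x, some y, some z} := by
  rw [not_colsIndepR_triple (by simpa using hxy) (by simpa using hxz) (by simpa using hyz)]
  refine ⟨GainIdx.gain (some y) - GainIdx.gain (some z),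
    GainIdx.gain (some z) - GainIdx.gain (some x),
    GainIdx.gain (some x) - GainIdx.gain (some y), ?_, ?_⟩
  · refine Or.inl fun h => hyz (eq_of_pair_eq (h1.symm.trans h2) ?_)
    exact_mod_cast sub_eq_zero.mp h
  · rw [gainMatrix_relation]
    refine ⟨by ring, fun s => ?_⟩
    rw [← inc_some_congr h1, ← inc_some_congr h2]
    ring

/-- A line with at least four points contains the tip. -/
theorem pair_eq_of_long_line
    {x a : Σ p : PairIdx (n + 1), Finset.Icc (-(w p.1.2 : ℤ)) (w p.1.1)} {b c : GainIdx w}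
    (hxa : some x ≠ some a) (hxb : some x ≠ b) (hxc : some x ≠ c) (hab : some a ≠ b)
    (hac : some a ≠ c) (hbc : b ≠ c)
    (h1 : ¬ ColsIndepR (gainMatrix w) {some x, some a, b})
    (h2 : ¬ ColsIndepR (gainMatrix w) {some x, some a, c}) : x.1 = a.1 := by
  by_contra hp
  obtain ⟨s, hs, hs'⟩ := exists_inc_ne_zero hp
  obtain ⟨t, ht, ht'⟩ := exists_inc_ne_zero (Ne.symm hp)
  have hst : s ≠ t := by
    rintro rfl
    exact ht hs'
  obtain ⟨α, β, γ, hα, hβ, hγ, hg, hi⟩ := exists_relation hxa hxb hab h1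
  obtain ⟨α', β', γ', hα', hβ', hγ', hg', hi'⟩ := exists_relation hxa hxc hac h2
  have bs : b.inc s ≠ 0 := fun h => by simpa [hs, hs', h, hα] using hi s
  have bt : b.inc t ≠ 0 := fun h => by simpa [ht, ht', h, hβ] using hi t
  have cs : c.inc s ≠ 0 := fun h => by simpa [hs, hs', h, hα'] using hi' s
  have ct : c.inc t ≠ 0 := fun h => by simpa [ht, ht', h, hβ'] using hi' t
  rcases b with _ | b
  · simp at bs
  rcases c with _ | c
  · simp at cs
  have hpbc := pair_eq_of_inc hst bs bt cs ct
  have e : ∀ u, (γ' * α - γ * α') * (GainIdx.inc (some x) u : ℝ) +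
      (γ' * β - γ * β') * (GainIdx.inc (some a) u : ℝ) = 0 := fun u => by
    have h := hi u
    rw [inc_some_congr hpbc] at h
    linear_combination γ' * h - γ * hi' u
  have e1 : γ' * α - γ * α' = 0 := by simpa [hs, hs'] using e s
  have e2 : γ' * β - γ * β' = 0 := by simpa [ht, ht'] using e t
  have e3 : γ * γ' * ((GainIdx.gain (some b) : ℝ) - GainIdx.gain (some c)) = 0 := by
    linear_combination γ' * hg - γ * hg' - e1 * (GainIdx.gain (some x) : ℝ) -
      e2 * (GainIdx.gain (some a) : ℝ)
  have e4 := (mul_eq_zero.mp e3).resolve_left (mul_ne_zero hγ hγ')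
  exact hbc (congrArg some (eq_of_pair_eq hpbc (by exact_mod_cast sub_eq_zero.mp e4)))

theorem long_line_cases {x a b c : GainIdx w} (hx : x ≠ none)
    (hxa : x ≠ a) (hxb : x ≠ b) (hxc : x ≠ c) (hab : a ≠ b) (hac : a ≠ c) (hbc : b ≠ c)
    (h1 : ¬ ColsIndepR (gainMatrix w) {x, a, b}) (h2 : ¬ ColsIndepR (gainMatrix w) {x, a, c}) :
    a = none ∨ ∃ y z, x = some y ∧ a = some z ∧ y.1 = z.1 := by
  rcases x with _ | x
  · exact absurd rfl hx
  rcases a with _ | a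
  · exact Or.inl rfl
  · exact Or.inr ⟨x, a, rfl, rfl, pair_eq_of_long_line hxa hxb hxc hab hac hbc h1 h2⟩

theorem not_colsIndepR_map {r r' : ℕ} {ι ι' : Type} {A : Matrix (Fin r) ι ℤ}
    {B : Matrix (Fin r') ι' ℤ} {σ : ι ≃ ι'}
    (hσ : ∀ S : Set ι, ColsIndepR A S ↔ ColsIndepR B (σ '' S)) (x y z : ι) :
    ¬ ColsIndepR B {σ x, σ y, σ z} ↔ ¬ ColsIndepR A {x, y, z} := by
  rw [hσ, Set.image_insert_eq, Set.image_pair]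

theorem exists_three_of_pair {p : PairIdx (n + 1)} (hp : 2 ≤ w p.1.1 + w p.1.2) :
    ∃ a b c : Σ p : PairIdx (n + 1), Finset.Icc (-(w p.1.2 : ℤ)) (w p.1.1),
      a.1 = p ∧ b.1 = p ∧ c.1 = p ∧ a ≠ b ∧ a ≠ c ∧ b ≠ c := by
  have hmem : ∀ k : ℕ, k ≤ 2 → -(w p.1.2 : ℤ) + k ∈ Finset.Icc (-(w p.1.2 : ℤ)) (w p.1.1) := by
    intro k hk
    rw [Finset.mem_Icc]
    omega
  refine ⟨⟨p, ⟨_, hmem 0 (by norm_num)⟩⟩, ⟨p, ⟨_, hmem 1 (by norm_num)⟩⟩,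
    ⟨p, ⟨_, hmem 2 le_rfl⟩⟩, rfl, rfl, rfl, ?_, ?_, ?_⟩ <;> simp

/-- An isomorphism fixes the tip as soon as two lines through the tip have four points. -/
theorem map_tip {σ : GainIdx w ≃ GainIdx w'}
    (hσ : ∀ S, ColsIndepR (gainMatrix w) S ↔ ColsIndepR (gainMatrix w') (σ '' S))
    {p q : PairIdx (n + 1)} (hpq : p ≠ q) (hp : 2 ≤ w p.1.1 + w p.1.2)
    (hq : 2 ≤ w q.1.1 + w q.1.2) : σ none = none := by
  by_contra hne
  have key : ∀ p : PairIdx (n + 1), 2 ≤ w p.1.1 + w p.1.2 →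
      ∃ a : Σ p : PairIdx (n + 1), Finset.Icc (-(w p.1.2 : ℤ)) (w p.1.1), a.1 = p ∧
        (σ (some a) = none ∨
          ∃ y z, σ none = some y ∧ σ (some a) = some z ∧ y.1 = z.1) := by
    intro p hp
    obtain ⟨a, b, c, ha, hb, hc, hab, hac, hbc⟩ := exists_three_of_pair hp
    refine ⟨a, ha, long_line_cases (b := σ (some b)) (c := σ (some c)) hne ?_ ?_ ?_ ?_ ?_ ?_
      ?_ ?_⟩
    · simp
    · simp
    · simp
    · simpa using hab
    · simpa using hac
    · simpa using hbc
    · rw [not_colsIndepR_map hσ, collinear_tip_iff hab, ha, hb]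
    · rw [not_colsIndepR_map hσ, collinear_tip_iff hac, ha, hc]
  obtain ⟨a, ha, h⟩ := key p hp
  obtain ⟨b, hb, h'⟩ := key q hq
  have hab : a ≠ b := by
    rintro rfl
    exact hpq (ha.symm.trans hb)
  have hσab : σ (some a) ≠ σ (some b) := by simpa using hab
  have hdep : ColsIndepR (gainMatrix w) {none, some a, some b} := by
    by_contra hcon
    exact hpq (by rw [← ha, ← hb, (collinear_tip_iff hab).mp hcon])
  rw [hσ, Set.image_insert_eq, Set.image_pair] at hdep
  have hna : σ none ≠ σ (some a) := by simp
  have hnb : σ none ≠ σ (some b) := by simp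
  rcases h with h | ⟨y, z, hy, hz, hyz⟩ <;> rcases h' with h' | ⟨y', z', hy', hz', hyz'⟩
  · exact hσab (h.trans h'.symm)
  · rw [hy', hz'] at hnb hdep
    rw [h, Set.insert_comm] at hdep
    exact (collinear_tip_iff (by simpa using hnb)).mpr hyz' hdep
  · rw [hy, hz] at hna hdep
    rw [h', Set.pair_comm, Set.insert_comm] at hdep
    exact (collinear_tip_iff (by simpa using hna)).mpr hyz hdep
  · obtain rfl : y = y' := Option.some.inj (hy.symm.trans hy')
    rw [hy, hz, hz'] at hdep
    rw [hy, hz] at hna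
    rw [hy, hz'] at hnb
    rw [hz, hz'] at hσab
    exact collinear_of_pair_eq (by simpa using hna) (by simpa using hnb) (by simpa using hσab)
      hyz hyz' hdep

/-- The points other than the tip on the line through the tip and `x`. -/
def tipLine (w : Fin (n + 1) → ℕ) (x : GainIdx w) : Set (GainIdx w) :=
  {y | x ≠ none ∧ y ≠ none ∧ (y = x ∨ ¬ ColsIndepR (gainMatrix w) {none, x, y})}

theorem ncard_tipLine_none : (tipLine w none).ncard = 0 := by
  simp [tipLine]

theorem ncard_tipLine_some (x : Σ p : PairIdx (n + 1), Finset.Icc (-(w p.1.2 : ℤ)) (w p.1.1)) :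
    (tipLine w (some x)).ncard = w x.1.1.1 + w x.1.1.2 + 1 := by
  have h : tipLine w (some x) = Set.range
      (fun k : Finset.Icc (-(w x.1.1.2 : ℤ)) (w x.1.1.1) => (some ⟨x.1, k⟩ : GainIdx w)) := by
    ext y
    rcases y with _ | y
    · simp [tipLine]
    · have : (some y ∈ tipLine w (some x)) ↔ x.1 = y.1 := by
        by_cases hxy : x = y
        · subst hxy
          simp [tipLine]
        · simp only [tipLine, Set.mem_ofPred_eq, collinear_tip_iff hxy]
          simp [Ne.symm hxy]
      rw [this]
      constructor
      · intro h
        obtain ⟨q, l⟩ := y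
        obtain rfl : x.1 = q := h
        exact ⟨l, rfl⟩
      · rintro ⟨k, hk⟩
        rw [← Option.some.inj hk]
  rw [h, ← Set.image_univ, Set.ncard_image_of_injective]
  · rw [Set.ncard_univ, Nat.card_eq_fintype_card, Fintype.card_coe, Int.card_Icc]
    omega
  · intro k l hkl
    simpa using hkl

theorem ncard_tipLine_map {σ : GainIdx w ≃ GainIdx w'}
    (hσ : ∀ S, ColsIndepR (gainMatrix w) S ↔ ColsIndepR (gainMatrix w') (σ '' S))
    (h0 : σ none = none) (x : GainIdx w) :
    (tipLine w' (σ x)).ncard = (tipLine w x).ncard := by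
  have : tipLine w' (σ x) = σ '' tipLine w x := by
    ext y
    obtain ⟨y, rfl⟩ := σ.surjective y
    rw [σ.injective.mem_set_image]
    simp only [tipLine, Set.mem_ofPred_eq]
    have hn : ∀ z, σ z = none ↔ z = none := fun z => by
      rw [← σ.apply_eq_iff_eq (x := z), h0]
    have := not_colsIndepR_map hσ none x y
    rw [h0] at this
    rw [this, Ne, Ne, hn, hn, σ.apply_eq_iff_eq]
  rw [this, Set.ncard_image_of_injective _ σ.injective]

open Polynomial in
/-- The sums of the weights over pairs, read off from the lengths of the lines through the tip. -/
theorem sum_tipLine (w : Fin (n + 1) → ℕ) :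
    ∑ x : GainIdx w, C ((tipLine w x).ncard : ℚ)⁻¹ * X ^ ((tipLine w x).ncard - 1) =
      ∑ p : PairIdx (n + 1), (X : ℚ[X]) ^ (w p.1.1 + w p.1.2) := by
  rw [Fintype.sum_option, ncard_tipLine_none, Fintype.sum_sigma]
  simp only [ncard_tipLine_some, Nat.cast_zero, inv_zero, map_zero, zero_mul, zero_add]
  refine Finset.sum_congr rfl fun p _ => ?_
  rw [Finset.sum_const, Finset.card_univ, Fintype.card_coe, Int.card_Icc]
  have : ((w p.1.1 : ℤ) + 1 - -(w p.1.2 : ℤ)).toNat = w p.1.1 + w p.1.2 + 1 := by omega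
  rw [this, nsmul_eq_mul, ← mul_assoc, ← C_eq_natCast, ← C_mul,
    mul_inv_cancel₀ (by positivity), C_1, one_mul, Nat.add_sub_cancel]

open Polynomial in
/-- Isomorphic gain matroids have the same weights up to order. -/
theorem sum_X_pow_eq_of_matroidIso (hiso : MatroidIso (gainMatrix w) (gainMatrix w'))
    {p q : PairIdx (n + 1)} (hpq : p ≠ q) (hp : 2 ≤ w p.1.1 + w p.1.2)
    (hq : 2 ≤ w q.1.1 + w q.1.2) (h0 : ∃ i, w i = 0) (h0' : ∃ i, w' i = 0) :
    ∑ i, (X : ℚ[X]) ^ w i = ∑ i, (X : ℚ[X]) ^ w' i := by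
  obtain ⟨σ, hσ⟩ := hiso
  refine sum_X_pow_eq_of_pairs h0 h0' ?_
  rw [← sum_tipLine, ← sum_tipLine, ← Equiv.sum_comp σ]
  simp only [ncard_tipLine_map hσ (map_tip hσ hpq hp hq)]

end GainMatrix

section Weights

variable {m n : ℕ}

/-- The vertex weights belonging to a sequence `lam`: `1, lam 0, lam 1, …`, padded with zeros. -/
def vertexWeight (n : ℕ) (lam : Fin m → ℕ) (t : Fin (n + 1)) : ℕ :=
  if t = 0 then 1 else if h : t.val - 1 < m then lam ⟨t.val - 1, h⟩ else 0

/-- The vertex carrying the weight `lam i`. -/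
def partVertex (hm : m ≤ n) (i : Fin m) : Fin (n + 1) := (Fin.castLE hm i).succ

@[simp] theorem partVertex_val (hm : m ≤ n) (i : Fin m) : (partVertex hm i).val = i.val + 1 := rfl

@[simp] theorem partVertex_ne_zero (hm : m ≤ n) (i : Fin m) : partVertex hm i ≠ 0 :=
  Fin.succ_ne_zero _

@[simp] theorem vertexWeight_zero (lam : Fin m → ℕ) : vertexWeight n lam 0 = 1 := if_pos rfl

@[simp] theorem vertexWeight_partVertex (hm : m ≤ n) (lam : Fin m → ℕ) (i : Fin m) :
    vertexWeight n lam (partVertex hm i) = lam i := by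
  simp [vertexWeight]

theorem exists_partVertex {hm : m ≤ n} {lam : Fin m → ℕ} {t : Fin (n + 1)} (ht : t ≠ 0)
    (hw : 0 < vertexWeight n lam t) : ∃ i, t = partVertex hm i := by
  have h0 : t.val ≠ 0 := fun h => ht (Fin.ext h)
  simp only [vertexWeight, ht, if_false] at hw
  split_ifs at hw with h
  · exact ⟨⟨t.val - 1, h⟩, Fin.ext (by simp; omega)⟩
  · simp at hw

/-- The labelled edge corresponding to a column of `ALam`. -/
def columnLabel (hm : m ≤ n) (lam : Fin m → ℕ) :
    ColIdxLam m (n + 1) lam → Fin (n + 1) × Fin (n + 1) × ℤ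
  | Sum.inl i => (0, i, if i = 0 then 1 else 0)
  | Sum.inr (Sum.inl p) => (p.1.1, p.1.2, if p.1.1 = 0 then 1 else 0)
  | Sum.inr (Sum.inr (Sum.inl ⟨i, k⟩)) => (0, partVertex hm i, -(k.val + 1 : ℤ))
  | Sum.inr (Sum.inr (Sum.inr ⟨i, k, j⟩)) =>
      if partVertex hm i < j.1 then (partVertex hm i, j.1, (k.val + 1 : ℤ))
      else (j.1, partVertex hm i, -(k.val + 1 : ℤ))

theorem ALam_eq_labelVec (hm : m ≤ n) (lam : Fin m → ℕ) (e : ColIdxLam m (n + 1) lam) :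
    (∀ t, ALam m (n + 1) lam t e = labelVec (columnLabel hm lam e) t) ∨
      (∀ t, ALam m (n + 1) lam t e = -labelVec (columnLabel hm lam e) t) := by
  rcases e with i | ⟨⟨i, j⟩, hij⟩ | ⟨i, k⟩ | ⟨i, k, j, hj0, hji⟩
  · by_cases hi : i = 0
    · left
      intro t
      simp [ALam, columnLabel, labelVec, hi]
    · right
      intro t
      simp only [ALam, columnLabel, labelVec, Matrix.of_apply]
      grind
  · left
    intro t
    simp only [ALam, columnLabel, labelVec, Matrix.of_apply]
    have : i < j := hij
    by_cases ht : t = 0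
    · subst ht
      grind
    · grind
  · right
    intro t
    simp only [ALam, columnLabel, labelVec, Matrix.of_apply, Fin.ext_iff, partVertex_val,
      Fin.val_zero]
    grind
  · by_cases h : partVertex hm i < j
    · left
      intro t
      simp only [ALam, columnLabel, labelVec, Matrix.of_apply, h, if_true, Fin.ext_iff,
        partVertex_val, Fin.val_zero]
      grind
    · right
      intro t
      simp only [ALam, columnLabel, labelVec, Matrix.of_apply, h, if_false, Fin.ext_iff,
        partVertex_val, Fin.val_zero]
      grind

theorem columnLabel_injective (hm : m ≤ n) (lam : Fin m → ℕ) :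
    Function.Injective (columnLabel hm lam) := by
  have sigma_ext : ∀ {i i' : Fin m} {k : Fin (lam i)} {k' : Fin (lam i')}, i.val = i'.val →
      k.val = k'.val → (⟨i, k⟩ : Σ i, Fin (lam i)) = ⟨i', k'⟩ := by
    intro i i' k k' h1 h2
    obtain rfl := Fin.ext h1
    rw [Fin.ext h2]
  have sigma_ext' : ∀ {i i' : Fin m} {k : Fin (lam i)} {k' : Fin (lam i')}
      {j : {j : Fin (n + 1) // j.val ≠ 0 ∧ j.val ≠ i.val + 1}}
      {j' : {j : Fin (n + 1) // j.val ≠ 0 ∧ j.val ≠ i'.val + 1}}, i.val = i'.val →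
      k.val = k'.val → j.1.val = j'.1.val →
      (⟨i, k, j⟩ : Σ i : Fin m, Fin (lam i) ×
        {j : Fin (n + 1) // j.val ≠ 0 ∧ j.val ≠ i.val + 1}) = ⟨i', k', j'⟩ := by
    intro i i' k k' j j' h1 h2 h3
    obtain rfl := Fin.ext h1
    rw [Fin.ext h2, Subtype.ext (Fin.ext h3)]
  intro e f h
  rcases e with i | ⟨⟨i, j⟩, hij⟩ | ⟨i, k⟩ | ⟨i, k, j, hj0, hji⟩ <;>
  rcases f with i' | ⟨⟨i', j'⟩, hij'⟩ | ⟨i', k'⟩ | ⟨i', k', j', hj0', hji'⟩ <;>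
  simp only [columnLabel, apply_ite Prod.fst, apply_ite Prod.snd, Prod.ext_iff, Fin.ext_iff,
    Fin.lt_def, partVertex_val, apply_ite Fin.val, Fin.val_zero] at h <;>
  (try rw [Fin.lt_def] at hij) <;>
  (try rw [Fin.lt_def] at hij') <;>
  first
  | (exfalso; grind)
  | (congr 1; grind)

theorem GainIdx.label_injective {w : Fin (n + 1) → ℕ} :
    Function.Injective (GainIdx.label : GainIdx w → _) := by
  rintro (_ | ⟨⟨⟨i, j⟩, hij⟩, k, hk⟩) (_ | ⟨⟨⟨i', j'⟩, hij'⟩, k', hk'⟩) h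
  · rfl
  · simp only [GainIdx.label, Prod.mk.injEq] at h
    exact absurd hij' (by simp [← h.1, ← h.2.1])
  · simp only [GainIdx.label, Prod.mk.injEq] at h
    exact absurd hij (by simp [h.1, h.2.1])
  · simp only [GainIdx.label, Prod.mk.injEq] at h
    obtain ⟨rfl, rfl, rfl⟩ := h
    rfl

theorem mem_range_label {w : Fin (n + 1) → ℕ} {i j : Fin (n + 1)} {k : ℤ} (hij : i < j)
    (h1 : -(w j : ℤ) ≤ k) (h2 : k ≤ w i) :
    (i, j, k) ∈ Set.range (GainIdx.label : GainIdx w → _) :=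
  ⟨some ⟨⟨(i, j), hij⟩, ⟨k, Finset.mem_Icc.mpr ⟨h1, h2⟩⟩⟩, rfl⟩

theorem range_columnLabel (hm : m ≤ n) (lam : Fin m → ℕ) :
    Set.range (columnLabel hm lam) =
      Set.range (GainIdx.label : GainIdx (vertexWeight n lam) → _) := by
  apply Set.Subset.antisymm
  · rintro _ ⟨e, rfl⟩
    rcases e with i | ⟨⟨i, j⟩, hij⟩ | ⟨i, k⟩ | ⟨i, k, j, hj0, hji⟩
    · by_cases hi : i = 0
      · exact ⟨none, by simp [columnLabel, GainIdx.label, hi]⟩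
      · simp only [columnLabel, hi, if_false]
        exact mem_range_label (Fin.pos_of_ne_zero hi) (by simp) (by simp)
    · refine mem_range_label hij ?_ ?_
      · dsimp only
        split_ifs <;> omega
      · dsimp only
        split_ifs with h
        · simp [h]
        · simp
    · have := k.2
      refine mem_range_label (Fin.pos_of_ne_zero (partVertex_ne_zero hm i)) ?_ ?_
      · rw [vertexWeight_partVertex]
        omega
      · omega
    · have := k.2
      simp only [columnLabel]
      split_ifs with h
      · refine mem_range_label h (by omega) ?_
        rw [vertexWeight_partVertex]
        omega
      · refine mem_range_label ?_ ?_ (by omega)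
        · rw [Fin.lt_def, partVertex_val] at *
          omega
        · rw [vertexWeight_partVertex]
          omega
  · rintro _ ⟨_ | ⟨⟨⟨i, j⟩, hij⟩, k, hk⟩, rfl⟩
    · exact ⟨Sum.inl 0, by simp [columnLabel, GainIdx.label]⟩
    · rw [Finset.mem_Icc] at hk
      dsimp only at hk hij
      have hj : j ≠ 0 := (Fin.pos_iff_ne_zero.mp (lt_of_le_of_lt (Fin.zero_le i) hij))
      simp only [GainIdx.label]
      have hneg : k < 0 → ((i, j, k) : Fin (n + 1) × Fin (n + 1) × ℤ) ∈
          Set.range (columnLabel hm lam) := by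
        intro hk0
        obtain ⟨l, rfl⟩ := exists_partVertex (hm := hm) (lam := lam) hj (by omega)
        rw [vertexWeight_partVertex] at hk
        by_cases hi : i = 0
        · subst hi
          refine ⟨Sum.inr (Sum.inr (Sum.inl ⟨l, ⟨(-k - 1).toNat, by omega⟩⟩)), ?_⟩
          simp only [columnLabel, Prod.mk.injEq, true_and]
          omega
        · refine ⟨Sum.inr (Sum.inr (Sum.inr ⟨l, ⟨(-k - 1).toNat, by omega⟩, i,
            fun h => hi (Fin.ext h), ?_⟩)), ?_⟩
          · rw [Fin.lt_def, partVertex_val] at hij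
            omega
          · simp only [columnLabel, hij.not_gt, if_false, Prod.mk.injEq, true_and]
            omega
      by_cases hi : i = 0
      · subst hi
        rw [vertexWeight_zero] at hk
        rcases lt_trichotomy k 0 with h | rfl | h
        · exact hneg h
        · exact ⟨Sum.inl j, by simp [columnLabel, hj]⟩
        · obtain rfl : k = 1 := by omega
          exact ⟨Sum.inr (Sum.inl ⟨(0, j), hij⟩), by simp [columnLabel]⟩
      · rcases lt_trichotomy k 0 with h | rfl | h
        · exact hneg h
        · exact ⟨Sum.inr (Sum.inl ⟨(i, j), hij⟩), by simp [columnLabel, hi]⟩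
        · obtain ⟨l, rfl⟩ := exists_partVertex (hm := hm) (lam := lam) hi (by omega)
          rw [vertexWeight_partVertex] at hk
          refine ⟨Sum.inr (Sum.inr (Sum.inr ⟨l, ⟨(k - 1).toNat, by omega⟩, j,
            fun h => hj (Fin.ext h), ?_⟩)), ?_⟩
          · rw [Fin.lt_def, partVertex_val] at hij
            omega
          · simp only [columnLabel, hij, if_true, Prod.mk.injEq, true_and]
            omega

theorem matroidIso_gainMatrix (hm : m ≤ n) (lam : Fin m → ℕ) :
    MatroidIso (ALam m (n + 1) lam) (gainMatrix (vertexWeight n lam)) := by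
  let φ : ColIdxLam m (n + 1) lam ≃ GainIdx (vertexWeight n lam) :=
    (Equiv.ofInjective _ (columnLabel_injective hm lam)).trans
      ((Equiv.setCongr (range_columnLabel hm lam)).trans
        (Equiv.ofInjective _ GainIdx.label_injective).symm)
  refine MatroidIso.of_sign φ fun e => ?_
  have hφ : (φ e).label = columnLabel hm lam e :=
    Equiv.apply_ofInjective_symm GainIdx.label_injective _
  have hB : ∀ t, gainMatrix (vertexWeight n lam) t (φ e) = labelVec (columnLabel hm lam e) t :=
    fun t => by rw [← hφ]; rfl
  simp only [hB]
  exact ALam_eq_labelVec hm lam e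

theorem sum_vertexWeight {M : Type*} [AddCommMonoid M] (hm : m ≤ n) (lam : Fin m → ℕ)
    (g : ℕ → M) :
    ∑ t, g (vertexWeight n lam t) = g 1 + (∑ i, g (lam i) + (n - m) • g 0) := by
  obtain ⟨q, rfl⟩ := Nat.exists_eq_add_of_le hm
  rw [Fin.sum_univ_succ, Fin.sum_univ_add, vertexWeight_zero]
  simp [vertexWeight]

open Polynomial in
theorem coeff_sum_X_pow {ι : Type*} [Fintype ι] (v : ι → ℕ) (k : ℕ) :
    (∑ i, (X : ℚ[X]) ^ v i).coeff k = ∑ i, if k = v i then 1 else 0 := by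
  simp [finsetSum_coeff, coeff_X_pow]

/-- Antitone sequences of positive integers with the same value counts are equal. -/
theorem antitone_eq_of_count {m m' : ℕ} {lam : Fin m → ℕ} {lam' : Fin m' → ℕ}
    (hmono : Antitone lam) (hmono' : Antitone lam')
    (h : ∀ k, (List.ofFn lam).count k = (List.ofFn lam').count k) :
    ∃ e : m = m', ∀ i, lam i = lam' (Fin.cast e i) := by
  have heq : List.ofFn lam = List.ofFn lam' :=
    (List.perm_iff_count.mpr h).eq_of_sortedGE hmono.sortedGE_ofFn hmono'.sortedGE_ofFn
  obtain rfl : m = m' := by simpa using congrArg List.length heq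
  exact ⟨rfl, fun i => congrFun (List.ofFn_injective heq) i⟩

theorem count_ofFn (lam : Fin m → ℕ) (k : ℕ) :
    ((List.ofFn lam).count k : ℚ) = ∑ i, if k = lam i then 1 else 0 := by
  induction m with
  | zero => simp
  | succ m ih =>
    rw [List.ofFn_succ, List.count_cons, Fin.sum_univ_succ, Nat.cast_add, ih, add_comm]
    simp [show lam 0 = k ↔ k = lam 0 from eq_comm]

end Weights

theorem ALam_matroids_nonisomorphic (Δ r : ℕ) (hΔ : 2 ≤ Δ) (hr : Δ + 1 ≤ r)
    (m m' : ℕ) (lam : Fin m → ℕ) (lam' : Fin m' → ℕ)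
    (hpos : ∀ i, 0 < lam i) (hpos' : ∀ i, 0 < lam' i)
    (hmono : ∀ i j : Fin m, i ≤ j → lam j ≤ lam i)
    (hmono' : ∀ i j : Fin m', i ≤ j → lam' j ≤ lam' i)
    (hsum : ∑ i, lam i = Δ - 1) (hsum' : ∑ i, lam' i = Δ - 1)
    (hm : m + 1 ≤ r) (hm' : m' + 1 ≤ r)
    (hne : ¬ ∃ h : m = m', ∀ i : Fin m, lam i = lam' (Fin.cast h i)) :
    ¬ MatroidIso (ALam m r lam) (ALam m' r lam') := by
  intro hiso
  obtain ⟨n, rfl⟩ : ∃ n, r = n + 1 := ⟨r - 1, by omega⟩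
  have hmn : m ≤ Δ - 1 := by
    rw [← hsum]
    simpa using Finset.sum_le_sum fun i (_ : i ∈ Finset.univ) => Nat.succ_le_of_lt (hpos i)
  have hmn' : m' ≤ Δ - 1 := by
    rw [← hsum']
    simpa using Finset.sum_le_sum fun i (_ : i ∈ Finset.univ) => Nat.succ_le_of_lt (hpos' i)
  have hmle : m ≤ n := by omega
  have hmle' : m' ≤ n := by omega
  have hzero : ∀ {m : ℕ} (lam : Fin m → ℕ), m ≤ Δ - 1 → ∃ i, vertexWeight n lam i = 0 := by
    intro m lam h
    refine ⟨Fin.last n, ?_⟩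
    rw [vertexWeight, if_neg (by rw [Fin.ext_iff]; simp; omega), dif_neg (by simp; omega)]
  have hm0 : m ≠ 0 := by
    rintro rfl
    simp at hsum
    omega
  have hm0' : m' ≠ 0 := by
    rintro rfl
    simp at hsum'
    omega
  have hle : ∀ {m : ℕ} (lam : Fin m → ℕ), ∑ i, lam i = Δ - 1 → ∀ i, lam i ≤ Δ - 1 :=
    fun lam h i => h ▸ Finset.single_le_sum (fun j _ => Nat.zero_le (lam j)) (Finset.mem_univ i)
  have hΔ3 : 3 ≤ Δ := by
    by_contra hlt
    obtain rfl : Δ = 2 := by omega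
    obtain rfl : m = 1 := by omega
    obtain rfl : m' = 1 := by omega
    refine hne ⟨rfl, fun i => ?_⟩
    have := hpos i
    have := hpos' (Fin.cast rfl i)
    have := hle lam hsum i
    have := hle lam' hsum' (Fin.cast rfl i)
    omega
  have hw1 : vertexWeight n lam ⟨1, by omega⟩ = lam ⟨0, by omega⟩ := by
    simp [vertexWeight, Fin.ext_iff, show 0 < m by omega]
  have hpos0 := hpos ⟨0, by omega⟩
  have hw2 : 2 ≤ vertexWeight n lam ⟨1, by omega⟩ + vertexWeight n lam ⟨2, by omega⟩ := by
    rw [hw1]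
    by_contra hlt
    have hall : ∀ i, lam i ≤ 1 := fun i =>
      (hmono ⟨0, by omega⟩ i (Fin.le_def.mpr (Nat.zero_le _))).trans (by omega)
    have hm2 : 2 ≤ m := by
      have := Finset.sum_le_sum fun i (_ : i ∈ Finset.univ) => hall i
      simp at this
      omega
    have h2 : vertexWeight n lam ⟨2, by omega⟩ = lam ⟨1, by omega⟩ := by
      simp [vertexWeight, Fin.ext_iff, show 1 < m by omega]
    have := hpos ⟨1, by omega⟩
    omega
  have hpoly := sum_X_pow_eq_of_matroidIso
    (((matroidIso_gainMatrix hmle lam).symm.trans hiso).trans (matroidIso_gainMatrix hmle' lam'))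
    (p := ⟨(0, ⟨1, by omega⟩), Fin.lt_def.mpr (by simp)⟩)
    (q := ⟨(⟨1, by omega⟩, ⟨2, by omega⟩), Fin.lt_def.mpr (by simp)⟩)
    (by simp [Fin.ext_iff]) (by simp only [hw1, vertexWeight_zero]; omega) hw2
    (hzero lam hmn) (hzero lam' hmn')
  refine hne (antitone_eq_of_count (fun i j h => hmono i j h) (fun i j h => hmono' i j h)
    fun k => ?_)
  rcases Nat.eq_zero_or_pos k with rfl | hk
  · rw [List.count_eq_zero_of_not_mem, List.count_eq_zero_of_not_mem]
    · rw [List.mem_ofFn]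
      rintro ⟨i, hi⟩
      exact (hpos' i).ne' hi
    · rw [List.mem_ofFn]
      rintro ⟨i, hi⟩
      exact (hpos i).ne' hi
  · have hc := congrArg (fun P => Polynomial.coeff P k) hpoly
    simp only [coeff_sum_X_pow] at hc
    rw [sum_vertexWeight hmle lam (fun v => if k = v then (1 : ℚ) else 0),
      sum_vertexWeight hmle' lam' (fun v => if k = v then (1 : ℚ) else 0), if_neg hk.ne',
      smul_zero, smul_zero, add_zero, add_zero, ← count_ofFn, ← count_ofFn] at hc
    exact_mod_cast add_left_cancel hc
end

section
/- Let Δ ≥ 2 and r ≥ Δ+1 be integers and let λ = (λ_1 ≥ … ≥ λ_m) be a partition of Δ−1. Then the column vector matroid of A(Δ,λ,r) is not isomorphic to the column vector matroid of A(Δ,r): there is no bijection σ from the column index set of A(Δ,λ,r) to that of A(Δ,r) such that, for every set S of column indices, the columns of A(Δ,λ,r) indexed by S are linearly independent over ℝ if and only if the columns of A(Δ,r) indexed by σ(S) are linearly independent. -/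
/-- Column index type for the matrix `A(Δ, r)` of Lee, Paat, Stallknecht, and Xu:
unit columns, difference columns, and columns `k e_1 - e_i` for `i ∈ {2, …, r}`,
`k ∈ {2, …, Δ}` (the pair `(i', k') : Fin (r-1) × Fin (Δ-1)` stands for
`i = i' + 2`, `k = k' + 2` in 1-based terms). -/
abbrev ColIdx0 (Δ r : ℕ) := Fin r ⊕ PairIdx r ⊕ (Fin (r - 1) × Fin (Δ - 1))

/-- The matrix `A(Δ, r)`. -/
def A0 (Δ r : ℕ) : Matrix (Fin r) (ColIdx0 Δ r) ℤ :=
  Matrix.of fun t j =>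
    match j with
    | Sum.inl i => if t = i then 1 else 0
    | Sum.inr (Sum.inl p) => if t = p.val.1 then 1 else if t = p.val.2 then -1 else 0
    | Sum.inr (Sum.inr (i, k)) =>
        if t.val = 0 then (k.val + 2 : ℤ) else if t.val = i.val + 1 then -1 else 0

/-- Three vectors supported on two common coordinates satisfy a nontrivial linear relation. -/
theorem exists_relation_of_support_pair {τ : Type*} (u v w : τ → ℝ) (s s' : τ)
    (hu : ∀ t, t ≠ s → t ≠ s' → u t = 0) (hv : ∀ t, t ≠ s → t ≠ s' → v t = 0)
    (hw : ∀ t, t ≠ s → t ≠ s' → w t = 0) :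
    ∃ a b c : ℝ, ¬ (a = 0 ∧ b = 0 ∧ c = 0) ∧ ∀ t, a * u t + b * v t + c * w t = 0 := by
  by_cases h : u s * v s' - u s' * v s = 0
  · by_cases h₀ : u s = 0 ∧ v s = 0
    · by_cases h₁ : u s' = 0 ∧ v s' = 0
      · refine ⟨1, 0, 0, by simp, fun t => ?_⟩
        by_cases ht : t = s
        · subst ht; simp [h₀.1]
        by_cases ht' : t = s'
        · subst ht'; simp [h₁.1]
        simp [hu t ht ht']
      · refine ⟨v s', -u s', 0, fun hh => h₁ ⟨by linarith [hh.2.1], hh.1⟩, fun t => ?_⟩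
        by_cases ht : t = s
        · subst ht; simp [h₀.1, h₀.2]
        by_cases ht' : t = s'
        · subst ht'; ring
        simp [hu t ht ht', hv t ht ht']
    · refine ⟨v s, -u s, 0, fun hh => h₀ ⟨by linarith [hh.2.1], hh.1⟩, fun t => ?_⟩
      by_cases ht : t = s
      · subst ht; ring
      by_cases ht' : t = s'
      · subst ht'; linarith
      simp [hu t ht ht', hv t ht ht']
  · refine ⟨v s * w s' - v s' * w s, w s * u s' - w s' * u s, u s * v s' - u s' * v s,
      fun hh => h hh.2.2, fun t => ?_⟩
    by_cases ht : t = s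
    · subst ht; ring
    by_cases ht' : t = s'
    · subst ht'; ring
    simp [hu t ht ht', hv t ht ht', hw t ht ht']

/-- The incidence vector of the directed edge from `q` to `p`. -/
def edgeVec {r : ℕ} (p q t : Fin r) : ℝ := (if t = p then 1 else 0) - (if t = q then 1 else 0)

theorem sum_edgeVec {r : ℕ} (p q : Fin r) : ∑ t, edgeVec p q t = 0 := by
  simp [edgeVec]

theorem edgeVec_ne_zero {r : ℕ} {p q t : Fin r} (h : edgeVec p q t ≠ 0) : t = p ∨ t = q := by
  by_contra! hh
  simp [edgeVec, hh.1, hh.2] at h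

theorem edgeVec_left_ne_zero {r : ℕ} {p q : Fin r} (h : p ≠ q) : edgeVec p q p ≠ 0 := by
  simp [edgeVec, h]

theorem edgeVec_right_ne_zero {r : ℕ} {p q : Fin r} (h : p ≠ q) : edgeVec p q q ≠ 0 := by
  simp [edgeVec, h.symm]

/-- An edge vector which is nonzero at two distinct vertices takes opposite values there. -/
theorem edgeVec_add_eq_zero {r : ℕ} {p q s t : Fin r} (hst : s ≠ t)
    (hs : edgeVec p q s ≠ 0) (ht : edgeVec p q t ≠ 0) :
    edgeVec p q s + edgeVec p q t = 0 := by
  rcases edgeVec_ne_zero hs with rfl | rfl <;> rcases edgeVec_ne_zero ht with rfl | rfl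
  · exact absurd rfl hst
  · simp [edgeVec, hst, hst.symm]
  · simp [edgeVec, hst, hst.symm]
  · exact absurd rfl hst

/-- A linear relation between vectors that agree with edge vectors away from the coordinate `o`
is a relation between the edge vectors. -/
theorem edgeVec_relation {r : ℕ} (o : Fin r) {p q p' q' p'' q'' : Fin r} {u v w : Fin r → ℝ}
    (hu : ∀ t, t ≠ o → u t = edgeVec p q t) (hv : ∀ t, t ≠ o → v t = edgeVec p' q' t)
    (hw : ∀ t, t ≠ o → w t = edgeVec p'' q'' t) {a b c : ℝ}
    (h : ∀ t, a * u t + b * v t + c * w t = 0) (t : Fin r) :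
    a * edgeVec p q t + b * edgeVec p' q' t + c * edgeVec p'' q'' t = 0 := by
  have key : ∀ t, t ≠ o →
      a * edgeVec p q t + b * edgeVec p' q' t + c * edgeVec p'' q'' t = 0 := fun t ht => by
    rw [← hu t ht, ← hv t ht, ← hw t ht, h t]
  by_cases ht : t = o
  · subst ht
    rw [← Finset.sum_eq_single (s := Finset.univ) t
      (f := fun t => a * edgeVec p q t + b * edgeVec p' q' t + c * edgeVec p'' q'' t)
      (fun s _ hs => key s hs) (by simp)]
    simp [Finset.sum_add_distrib, ← Finset.mul_sum, sum_edgeVec]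
  · exact key t ht

/-- Vectors `v x` which equal `k x` in the coordinate `o` and an edge vector elsewhere, and which
span a plane while being pairwise independent: if there are at least four of them, then all
nonzero edges among them are parallel. -/
theorem edges_parallel {κ : Type*} [Fintype κ] {r : ℕ} (o : Fin r)
    (p q : κ → Fin r) (v : κ → Fin r → ℝ)
    (hv : ∀ x t, t ≠ o → v x t = edgeVec (p x) (q x) t)
    (hcard : 4 ≤ Fintype.card κ)
    (hpair : ∀ x y, x ≠ y → ∀ a b : ℝ, (∀ t, a * v x t + b * v y t = 0) → a = 0 ∧ b = 0)
    (htri : ∀ x y z, x ≠ y → x ≠ z → y ≠ z →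
      ∃ a b c : ℝ, ¬ (a = 0 ∧ b = 0 ∧ c = 0) ∧ ∀ t, a * v x t + b * v y t + c * v z t = 0)
    (x y : κ) (hx : p x ≠ q x) (hy : p y ≠ q y) :
    (p x = p y ∧ q x = q y) ∨ (p x = q y ∧ q x = p y) := by
  classical
  by_contra hne
  have htri' : ∀ x y z, x ≠ y → x ≠ z → y ≠ z → ∃ a b c : ℝ, a ≠ 0 ∧ b ≠ 0 ∧ c ≠ 0 ∧
      ∀ t, a * edgeVec (p x) (q x) t + b * edgeVec (p y) (q y) t
        + c * edgeVec (p z) (q z) t = 0 := by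
    intro x y z hxy hxz hyz
    obtain ⟨a, b, c, h0, h⟩ := htri x y z hxy hxz hyz
    refine ⟨a, b, c, ?_, ?_, ?_, edgeVec_relation o (hv x) (hv y) (hv z) h⟩
    · rintro rfl
      exact h0 ⟨rfl, hpair y z hyz b c fun t => by linarith [h t]⟩
    · rintro rfl
      obtain ⟨ha, hc⟩ := hpair x z hxz a c fun t => by linarith [h t]
      exact h0 ⟨ha, rfl, hc⟩
    · rintro rfl
      obtain ⟨ha, hb⟩ := hpair x y hxy a b fun t => by linarith [h t]
      exact h0 ⟨ha, hb, rfl⟩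
  have hxy : x ≠ y := by
    rintro rfl
    exact hne (Or.inl ⟨rfl, rfl⟩)
  obtain ⟨s, hsx, hsy⟩ : ∃ s, edgeVec (p x) (q x) s ≠ 0 ∧ edgeVec (p y) (q y) s = 0 := by
    by_contra! h
    have h1 := edgeVec_ne_zero (h _ (edgeVec_left_ne_zero hx))
    have h2 := edgeVec_ne_zero (h _ (edgeVec_right_ne_zero hx))
    grind
  obtain ⟨s', hsy', hsx'⟩ : ∃ s, edgeVec (p y) (q y) s ≠ 0 ∧ edgeVec (p x) (q x) s = 0 := by
    by_contra! h
    have h1 := edgeVec_ne_zero (h _ (edgeVec_left_ne_zero hy))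
    have h2 := edgeVec_ne_zero (h _ (edgeVec_right_ne_zero hy))
    grind
  have hss : s ≠ s' := by
    rintro rfl
    exact hsx hsx'
  have third : ∀ z, z ≠ x → z ≠ y →
      edgeVec (p z) (q z) s ≠ 0 ∧ edgeVec (p z) (q z) s' ≠ 0 := by
    intro z hzx hzy
    obtain ⟨a, b, c, ha, hb, -, h⟩ := htri' x y z hxy hzx.symm hzy.symm
    constructor
    · intro h0
      have := h s
      rw [h0, hsy] at this
      simp [ha, hsx] at this
    · intro h0
      have := h s'
      rw [h0, hsx'] at this
      simp [hb, hsy'] at this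
  obtain ⟨z, hz⟩ : ∃ z, z ∉ ({x, y} : Finset κ) :=
    by_contra fun h => by
      push Not at h
      have := Finset.card_le_two (a := x) (b := y)
      rw [Finset.eq_univ_iff_forall.2 h, Finset.card_univ] at this
      omega
  obtain ⟨w, hw⟩ : ∃ w, w ∉ ({x, y, z} : Finset κ) :=
    by_contra fun h => by
      push Not at h
      have := Finset.card_le_three (a := x) (b := y) (c := z)
      rw [Finset.eq_univ_iff_forall.2 h, Finset.card_univ] at this
      omega
  simp only [Finset.mem_insert, Finset.mem_singleton, not_or] at hz hw
  obtain ⟨hzs, hzs'⟩ := third z hz.1 hz.2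
  obtain ⟨hws, hws'⟩ := third w hw.1 hw.2.1
  obtain ⟨a, b, c, -, -, hc, h⟩ := htri' z w x (Ne.symm hw.2.2) hz.1 hw.1
  have e1 := edgeVec_add_eq_zero hss hzs hzs'
  have e2 := edgeVec_add_eq_zero hss hws hws'
  have h1 := h s
  have h2 := h s'
  rw [hsx'] at h2
  have : c * edgeVec (p x) (q x) s = 0 := by
    linear_combination h1 + h2 - a * e1 - b * e2
  simp [hc, hsx] at this

/-- A long line among columns `k e_o + (edge vector)`, with `0 ≤ k ≤ L p` where `p` is the head of
the edge and `∑ L` is small, is supported on two prescribed coordinates. -/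
theorem long_line_support {κ : Type*} [Fintype κ] {r : ℕ} (o o' : Fin r) (hoo : o ≠ o')
    (p q : κ → Fin r) (k : κ → ℤ) (v : κ → Fin r → ℝ) (L : Fin r → ℕ)
    (hvo : ∀ x, v x o = k x)
    (hv : ∀ x t, t ≠ o → v x t = edgeVec (p x) (q x) t)
    (hk0 : ∀ x, 0 ≤ k x) (hkL : ∀ x, k x ≤ L (p x)) (hloop : ∀ x, p x = q x → k x = 1)
    (hcard : 4 ≤ Fintype.card κ) (hL : (∑ t, L t) + 2 ≤ Fintype.card κ)
    (ho : 0 < L o) (ho' : 0 < L o')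
    (hpair : ∀ x y, x ≠ y → ∀ a b : ℝ, (∀ t, a * v x t + b * v y t = 0) → a = 0 ∧ b = 0)
    (htri : ∀ x y z, x ≠ y → x ≠ z → y ≠ z →
      ∃ a b c : ℝ, ¬ (a = 0 ∧ b = 0 ∧ c = 0) ∧ ∀ t, a * v x t + b * v y t + c * v z t = 0)
    (x : κ) (t : Fin r) (hto : t ≠ o) (hto' : t ≠ o') : v x t = 0 := by
  classical
  have par := edges_parallel o p q v hv hcard hpair htri
  have heq : ∀ x y, p x = p y → q x = q y → k x = k y → x = y := by
    intro x y hp hq hk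
    by_contra hxy
    have := hpair x y hxy 1 (-1) fun t => by
      by_cases ht : t = o
      · subst ht; rw [hvo, hvo, hk]; ring
      · rw [hv x t ht, hv y t ht, hp, hq]; ring
    simp at this
  have hneg : ∀ x y, p x = q y → q x = p y → p x ≠ q x → k x ≠ - k y := by
    intro x y hp hq hpq hk
    have hxy : x ≠ y := by
      rintro rfl
      exact hpq hp
    have := hpair x y hxy 1 1 fun t => by
      by_cases ht : t = o
      · subst ht; rw [hvo, hvo, hk]; push_cast; ring
      · rw [hv x t ht, hv y t ht, hp, hq]; simp [edgeVec]
    simp at this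
  have hdeg : (Finset.univ.filter fun x => p x = q x).card ≤ 1 := by
    refine Finset.card_le_one.2 fun x hx y hy => ?_
    simp only [Finset.mem_filter, Finset.mem_univ, true_and] at hx hy
    by_contra hxy
    have := hpair x y hxy 1 (-1) fun t => by
      by_cases ht : t = o
      · subst ht; rw [hvo, hvo, hloop x hx, hloop y hy]; ring
      · rw [hv x t ht, hv y t ht, hx, hy]; simp [edgeVec]
    simp at this
  have hsplit := Finset.card_filter_add_card_filter_not (s := (Finset.univ : Finset κ))
    (fun x => p x = q x)
  rw [Finset.card_univ] at hsplit
  by_cases hx : p x = q x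
  · rw [hv x t hto, hx]; simp [edgeVec]
  have hle : (Finset.univ.filter fun y => ¬ p y = q y).card ≤
      (Finset.Icc (-(L (q x) : ℤ)) (L (p x))).card := by
    refine Finset.card_le_card_of_injOn (fun y => if p y = p x then k y else - k y) ?_ ?_
    · intro y hy
      simp only [Finset.coe_filter, Finset.mem_univ, true_and, Set.mem_ofPred_eq] at hy
      have h0 := hk0 y
      have h1 := hkL y
      rcases par y x hy hx with ⟨h, h'⟩ | ⟨h, h'⟩
      · rw [h] at h1
        simp only [h, if_true, Finset.coe_Icc, Set.mem_Icc]
        omega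
      · rw [h] at h1
        have : q x ≠ p x := Ne.symm hx
        simp only [h, this, if_false, Finset.coe_Icc, Set.mem_Icc]
        omega
    · intro y hy z hz hyz
      simp only [Finset.coe_filter, Finset.mem_univ, true_and, Set.mem_ofPred_eq] at hy hz
      have hqp : q x ≠ p x := Ne.symm hx
      rcases par y x hy hx with ⟨h, h'⟩ | ⟨h, h'⟩ <;> rcases par z x hz hx with ⟨g, g'⟩ | ⟨g, g'⟩
      · simp only [h, g, if_true] at hyz
        exact heq y z (h.trans g.symm) (h'.trans g'.symm) hyz
      · simp only [h, g, hqp, if_true, if_false] at hyz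
        exact absurd hyz (hneg y z (h.trans g'.symm) (h'.trans g.symm) hy)
      · simp only [h, g, hqp, if_true, if_false] at hyz
        exact absurd hyz.symm (hneg z y (g.trans h'.symm) (g'.trans h.symm) hz)
      · simp only [h, g, hqp, if_false, neg_inj] at hyz
        exact heq y z (h.trans g.symm) (h'.trans g'.symm) hyz
  rw [Int.card_Icc] at hle
  have hpq : ∀ s, 0 < L s → s = p x ∨ s = q x := by
    intro s hs
    by_contra! hh
    have h3 : ∑ t ∈ {p x, q x, s}, L t ≤ ∑ t, L t :=
      Finset.sum_le_sum_of_subset (Finset.subset_univ _)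
    rw [Finset.sum_insert (by simp [hx, hh.1.symm]), Finset.sum_insert (by simp [hh.2.symm]),
      Finset.sum_singleton] at h3
    omega
  rw [hv x t hto]
  by_contra h
  have := edgeVec_ne_zero h
  have h1 := hpq o ho
  have h2 := hpq o' ho'
  grind

/-- The largest admissible coefficient of `e_1` in a column of `A(Δ, λ, r)` whose tail has head
`t`. -/
def headBound (m : ℕ) (lam : Fin m → ℕ) (t : ℕ) : ℕ :=
  if t = 0 then 1 else if h : t - 1 < m then lam ⟨t - 1, h⟩ else 0

theorem headBound_succ {m : ℕ} (lam : Fin m → ℕ) (i : Fin m) :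
    headBound m lam (i.val + 1) = lam i := by
  simp [headBound]

theorem sum_headBound {m r : ℕ} (lam : Fin m → ℕ) (hm : m + 1 ≤ r) :
    ∑ t : Fin r, headBound m lam t.val = ∑ i, lam i + 1 := by
  rw [Fin.sum_univ_eq_sum_range (headBound m lam) r,
    ← Finset.sum_subset (Finset.range_subset_range.2 hm), Finset.sum_range_succ',
    ← Fin.sum_univ_eq_sum_range (fun i => headBound m lam (i + 1)) m]
  · simp only [headBound_succ]
    simp [headBound]
  · intro t _ ht
    simp only [Finset.mem_range] at ht
    rw [headBound, if_neg (by omega), dif_neg (by omega)]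

/-- Every column of `A(Δ, λ, r)` is a multiple of `e_1` plus an edge vector. -/
theorem ALam_column {m r : ℕ} (lam : Fin m → ℕ) (hm : m + 1 ≤ r) (o : Fin r) (ho : o.val = 0)
    (c : ColIdxLam m r lam) :
    ∃ (p q : Fin r) (k : ℤ), ALam m r lam o c = k ∧
      (∀ t, t ≠ o → (ALam m r lam t c : ℝ) = edgeVec p q t) ∧
      0 ≤ k ∧ k ≤ headBound m lam p.val ∧ (p = q → k = 1) := by
  have hne : ∀ t : Fin r, t ≠ o → t.val ≠ 0 := fun t ht h => ht (Fin.ext (h.trans ho.symm))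
  rcases c with i | ⟨⟨i, j⟩, hij⟩ | ⟨i, k⟩ | ⟨i, k, j, hj0, hji⟩
  · refine ⟨i, o, if o = i then 1 else 0, by simp [ALam], fun t ht => ?_, ?_, ?_, ?_⟩
    · simp [ALam, edgeVec, ht]
    · split_ifs <;> simp
    · split_ifs with h
      · subst h; simp [headBound, ho]
      · simp
    · intro h; simp [h]
  · have hij' : i < j := hij
    have hjo : o ≠ j := by
      rintro rfl
      have : i.val < o.val := hij
      omega
    refine ⟨i, j, if o = i then 1 else 0, by simp [ALam, hjo], fun t ht => ?_, ?_, ?_, ?_⟩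
    · simp only [ALam, edgeVec, Matrix.of_apply]
      have := hij'.ne
      split_ifs <;> simp_all
    · split_ifs <;> simp
    · split_ifs with h
      · subst h; simp [headBound, ho]
      · simp
    · intro h; exact absurd h hij'.ne
  · refine ⟨⟨i.val + 1, by omega⟩, o, k.val + 1, by simp [ALam, ho], fun t ht => ?_, by omega, ?_, ?_⟩
    · simp [ALam, edgeVec, ht, hne t ht, Fin.ext_iff]
    · rw [headBound_succ]; have := k.isLt; omega
    · intro h; have := congrArg Fin.val h; simp [ho] at this
  · refine ⟨⟨i.val + 1, by omega⟩, j, k.val + 1, by simp [ALam, ho], fun t ht => ?_, by omega, ?_, ?_⟩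
    · simp only [ALam, edgeVec, Matrix.of_apply, hne t ht, if_false, Fin.ext_iff]
      split_ifs <;> first | omega | simp
    · rw [headBound_succ]; have := k.isLt; omega
    · intro h; exact absurd (congrArg Fin.val h).symm hji

theorem colsIndepR_pair {r : ℕ} {ι : Type} (A : Matrix (Fin r) ι ℤ) {x y : ι} (hxy : x ≠ y) :
    ColsIndepR A {x, y} ↔ ∀ a b : ℝ,
      (∀ t, a * (A t x : ℝ) + b * (A t y : ℝ) = 0) → a = 0 ∧ b = 0 := by
  have := LinearIndepOn.pair_iff (R := ℝ) (fun j : ι => fun i => ((A i j : ℤ) : ℝ)) hxy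
  simpa [funext_iff, ColsIndepR, LinearIndepOn] using this

theorem colsIndepR_triple {r : ℕ} {ι : Type} (A : Matrix (Fin r) ι ℤ) {x y z : ι}
    (hxy : x ≠ y) (hxz : x ≠ z) (hyz : y ≠ z) :
    ColsIndepR A {x, y, z} ↔ ∀ a b c : ℝ,
      (∀ t, a * (A t x : ℝ) + b * (A t y : ℝ) + c * (A t z : ℝ) = 0) →
        a = 0 ∧ b = 0 ∧ c = 0 := by
  classical
  have := linearIndepOn_finset_iff (R := ℝ) (s := ({x, y, z} : Finset ι))
    (v := fun j : ι => fun i => ((A i j : ℤ) : ℝ))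
  have hsum : ∀ g : ι → ℝ, ∑ i ∈ ({x, y, z} : Finset ι), g i • (fun t => ((A t i : ℤ) : ℝ)) = 0 ↔
      ∀ t, g x * (A t x : ℝ) + g y * (A t y : ℝ) + g z * (A t z : ℝ) = 0 := by
    intro g
    rw [Finset.sum_insert (by simp [hxy, hxz]), Finset.sum_insert (by simp [hyz]),
      Finset.sum_singleton]
    simp [funext_iff, add_assoc]
  simp only [hsum] at this
  rw [Finset.coe_insert, Finset.coe_insert, Finset.coe_singleton] at this
  refine this.trans ⟨fun h a b c habc => ?_, fun h g hg => ?_⟩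
  · have := h (fun i => if i = x then a else if i = y then b else c)
      (fun t => by simpa [hxy.symm, hxz.symm, hyz.symm] using habc t)
    simpa [hxy.symm, hxz.symm, hyz.symm] using this
  · simpa using h (g x) (g y) (g z) hg

/-- The columns of `A(Δ, r)` on the line through `e_1` and `e_i`, where `i = i' + 2`. -/
def longLine {Δ r : ℕ} (o : Fin r) (i : Fin (r - 1)) (ho : o.val = 0) :
    Fin 3 ⊕ Fin (Δ - 1) → ColIdx0 Δ r
  | Sum.inl 0 => Sum.inl o
  | Sum.inl 1 => Sum.inl ⟨i.val + 1, by omega⟩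
  | Sum.inl 2 => Sum.inr (Sum.inl ⟨(o, ⟨i.val + 1, by omega⟩), by
      rw [Fin.lt_def]; simp [ho]⟩)
  | Sum.inr k => Sum.inr (Sum.inr (i, k))

theorem longLine_support {Δ r : ℕ} (o : Fin r) (i : Fin (r - 1)) (ho : o.val = 0)
    (x : Fin 3 ⊕ Fin (Δ - 1)) (t : Fin r) (hto : t ≠ o) (hti : t ≠ ⟨i.val + 1, by omega⟩) :
    A0 Δ r t (longLine o i ho x) = 0 := by
  have h0 : t.val ≠ 0 := fun h => hto (Fin.ext (h.trans ho.symm))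
  have h1 : t.val ≠ i.val + 1 := fun h => hti (Fin.ext h)
  rcases x with x | k
  · fin_cases x <;> simp [longLine, A0, hto, hti]
  · simp [longLine, A0, h0, h1]

theorem longLine_injective {Δ r : ℕ} (o : Fin r) (i : Fin (r - 1)) (ho : o.val = 0) :
    Function.Injective (longLine (Δ := Δ) o i ho) := by
  rintro (x | k) (y | l) h
  · fin_cases x <;> fin_cases y <;> simp_all [longLine, Fin.ext_iff]
  · fin_cases x <;> simp [longLine] at h
  · fin_cases y <;> simp [longLine] at h
  · simpa [longLine] using h

theorem longLine_pair_indep {Δ r : ℕ} (o : Fin r) (i : Fin (r - 1)) (ho : o.val = 0)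
    (x y : Fin 3 ⊕ Fin (Δ - 1)) (hxy : x ≠ y) (a b : ℝ)
    (h : ∀ t, a * (A0 Δ r t (longLine o i ho x) : ℝ) + b * (A0 Δ r t (longLine o i ho y) : ℝ) = 0) :
    a = 0 ∧ b = 0 := by
  have h0 := h o
  have h1 := h ⟨i.val + 1, by omega⟩
  have hoi : o ≠ ⟨i.val + 1, by omega⟩ := fun hh => by
    have := congrArg Fin.val hh
    simp [ho] at this
  rcases x with x | k <;> rcases y with y | l
  · fin_cases x <;> fin_cases y <;>
      simp [longLine, A0, hoi, hoi.symm] at h0 h1 hxy <;> constructor <;> linarith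
  · have hl : (0 : ℝ) ≤ l.val := by positivity
    fin_cases x <;> simp [longLine, A0, ho, hoi, hoi.symm] at h0 h1
    · simp_all
    · have hb : b = 0 := h0.resolve_right (by positivity)
      exact ⟨by linarith, hb⟩
    · have hb : b * (l.val + 1) = 0 := by linear_combination h0 + h1
      have hb : b = 0 := (mul_eq_zero.1 hb).resolve_right (by positivity)
      exact ⟨by linarith, hb⟩
  · have hl : (0 : ℝ) ≤ k.val := by positivity
    fin_cases y <;> simp [longLine, A0, ho, hoi, hoi.symm] at h0 h1
    · simp_all
    · have hb : a = 0 := h0.resolve_right (by positivity)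
      exact ⟨hb, by linarith⟩
    · have hb : a * (k.val + 1) = 0 := by linear_combination h0 + h1
      have hb : a = 0 := (mul_eq_zero.1 hb).resolve_right (by positivity)
      exact ⟨hb, by linarith⟩
  · simp [longLine, A0, ho] at h0 h1
    have hkl : (k.val : ℝ) - l.val ≠ 0 := by
      rw [sub_ne_zero]
      intro hh
      exact hxy (congrArg Sum.inr (Fin.ext (by exact_mod_cast hh)))
    have ha : a * ((k.val : ℝ) - l.val) = 0 := by linear_combination h0 + (l.val + 2) * h1
    have ha : a = 0 := (mul_eq_zero.1 ha).resolve_right hkl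
    exact ⟨ha, by linarith⟩

theorem ALam_not_isomorphic_to_A0 (Δ r : ℕ) (hΔ : 2 ≤ Δ) (hr : Δ + 1 ≤ r)
    (m : ℕ) (lam : Fin m → ℕ)
    (hpos : ∀ i, 0 < lam i)
    (hmono : ∀ i j : Fin m, i ≤ j → lam j ≤ lam i)
    (hsum : ∑ i, lam i = Δ - 1)
    (hm : m + 1 ≤ r) :
    ¬ MatroidIso (ALam m r lam) (A0 Δ r) := by
  rintro ⟨σ, hσ⟩
  have hm0 : 0 < m := by
    rcases Nat.eq_zero_or_pos m with rfl | h
    · simp at hsum; omega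
    · exact h
  let o : Fin r := ⟨0, by omega⟩
  let o' : Fin r := ⟨1, by omega⟩
  choose p q k hk hpq hk0 hkL hloop using ALam_column lam hm o rfl
  have hpair : ∀ x y, x ≠ y → (ColsIndepR (ALam m r lam) {σ.symm x, σ.symm y} ↔
      ColsIndepR (A0 Δ r) {x, y}) := fun x y _ => by
    rw [hσ]; simp [Set.image_pair]
  have htri : ∀ x y z, ColsIndepR (ALam m r lam) {σ.symm x, σ.symm y, σ.symm z} ↔
      ColsIndepR (A0 Δ r) {x, y, z} := fun x y z => by
    rw [hσ]; simp [Set.image_insert_eq]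
  have main : ∀ (i : Fin (r - 1)) (x : Fin 3 ⊕ Fin (Δ - 1)) (t : Fin r), t ≠ o → t ≠ o' →
      (ALam m r lam t (σ.symm (longLine o i rfl x)) : ℝ) = 0 := by
    intro i
    let g : Fin 3 ⊕ Fin (Δ - 1) → ColIdxLam m r lam := fun x => σ.symm (longLine o i rfl x)
    have hinj := longLine_injective (Δ := Δ) o i rfl
    have hcard : Fintype.card (Fin 3 ⊕ Fin (Δ - 1)) = Δ + 2 := by
      simp; omega
    refine long_line_support o o' (by simp [o, o']) (fun x => p (g x)) (fun x => q (g x))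
      (fun x => k (g x)) (fun x t => (ALam m r lam t (g x) : ℝ)) (fun t => headBound m lam t.val)
      (fun x => by simp only [hk]) (fun x => hpq (g x)) (fun x => hk0 (g x)) (fun x => hkL (g x))
      (fun x => hloop (g x)) (by omega) ?_ (by simp [headBound, o]) ?_ ?_ ?_
    · rw [sum_headBound lam hm]; omega
    · simpa [headBound, o', hm0] using hpos ⟨0, hm0⟩
    · intro x y hxy
      have hne := hinj.ne hxy
      exact (colsIndepR_pair _ (σ.symm.injective.ne hne)).1
        ((hpair _ _ hne).2 ((colsIndepR_pair _ hne).2 (longLine_pair_indep o i rfl x y hxy)))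
    · intro x y z hxy hxz hyz
      have h1 := hinj.ne hxy
      have h2 := hinj.ne hxz
      have h3 := hinj.ne hyz
      by_contra! hcon
      have hind := (htri _ _ _).1 ((colsIndepR_triple (ALam m r lam) (σ.symm.injective.ne h1)
        (σ.symm.injective.ne h2) (σ.symm.injective.ne h3)).2 fun a b c h => by
          by_contra hn
          obtain ⟨t, ht⟩ := hcon a b c (by tauto)
          exact ht (h t))
      rw [colsIndepR_triple _ h1 h2 h3] at hind
      obtain ⟨a, b, c, hn, h⟩ := exists_relation_of_support_pair
        (fun t => (A0 Δ r t (longLine o i rfl x) : ℝ))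
        (fun t => (A0 Δ r t (longLine o i rfl y) : ℝ))
        (fun t => (A0 Δ r t (longLine o i rfl z) : ℝ)) o ⟨i.val + 1, by omega⟩
        (fun t h h' => by simp only [longLine_support o i rfl x t h h', Int.cast_zero])
        (fun t h h' => by simp only [longLine_support o i rfl y t h h', Int.cast_zero])
        (fun t h h' => by simp only [longLine_support o i rfl z t h h', Int.cast_zero])
      exact hn (hind a b c h)
  let o'' : Fin r := ⟨2, by omega⟩
  have h1 : (Sum.inl o : ColIdx0 Δ r) ≠ Sum.inl o' := by simp [o, o']
  have h2 : (Sum.inl o : ColIdx0 Δ r) ≠ Sum.inl o'' := by simp [o, o'']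
  have h3 : (Sum.inl o' : ColIdx0 Δ r) ≠ Sum.inl o'' := by simp [o', o'']
  have hind : ColsIndepR (A0 Δ r) {Sum.inl o, Sum.inl o', Sum.inl o''} := by
    rw [colsIndepR_triple _ h1 h2 h3]
    intro a b c h
    have e1 := h o
    have e2 := h o'
    have e3 := h o''
    simp [A0, o, o', o''] at e1 e2 e3
    exact ⟨e1, e2, e3⟩
  rw [← htri, colsIndepR_triple _ (σ.symm.injective.ne h1) (σ.symm.injective.ne h2)
    (σ.symm.injective.ne h3)] at hind
  obtain ⟨a, b, c, hn, h⟩ := exists_relation_of_support_pair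
    (fun t => (ALam m r lam t (σ.symm (Sum.inl o)) : ℝ))
    (fun t => (ALam m r lam t (σ.symm (Sum.inl o')) : ℝ))
    (fun t => (ALam m r lam t (σ.symm (Sum.inl o'')) : ℝ)) o o'
    (main ⟨0, by omega⟩ (Sum.inl 0)) (main ⟨0, by omega⟩ (Sum.inl 1))
    (main ⟨1, by omega⟩ (Sum.inl 1))
  exact hn (hind a b c h)
end
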